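/- (First factorization of the Ruelle zeta function in terms of Selberg zeta functions.) Let m ∈ ℕ and s ∈ ℂ with Re(s) > 2 + m/2. Then Z(m + 2, s − m/2 + 1) and Z(−(m + 2), s + m/2 + 1) are nonzero, and ∏_{l=0}^{m} R(m − 2l, s − m/2 + l) = ( Z(m, s − m/2) · Z(−m, s + m/2 + 2) ) / ( Z(m + 2, s − m/2 + 1) · Z(−(m + 2), s + m/2 + 1) ). -/

import Mathlib

/-- `R(σ_k, s) = ∏_{i ∈ I} (1 − e^{i(k/2)θ_i} e^{−s ℓ_i})`. -/
noncomputable def Rz {I : Type*} (ℓ θ : I → ℝ) (k : ℤ) (s : ℂ) : ℂ :=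
  ∏' i : I, (1 - Complex.exp (Complex.I * ((k : ℂ) / 2) * (θ i : ℂ))
    * Complex.exp (-s * (ℓ i : ℂ)))

/-- Selberg zeta function
`Z(σ_k, s) = ∏_{i ∈ I} ∏_{p,q ≥ 0} (1 − e^{i(k/2)θ_i} e^{−p(ℓ_i+iθ_i)} e^{−q(ℓ_i−iθ_i)} e^{−s ℓ_i})`. -/
noncomputable def Zs {I : Type*} (ℓ θ : I → ℝ) (k : ℤ) (s : ℂ) : ℂ :=
  ∏' x : I × ℕ × ℕ,
    (1 - Complex.exp (Complex.I * ((k : ℂ) / 2) * (θ x.1 : ℂ))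
       * Complex.exp (-(x.2.1 : ℂ) * ((ℓ x.1 : ℂ) + Complex.I * (θ x.1 : ℂ)))
       * Complex.exp (-(x.2.2 : ℂ) * ((ℓ x.1 : ℂ) - Complex.I * (θ x.1 : ℂ)))
       * Complex.exp (-s * (ℓ x.1 : ℂ)))

lemma aux_mult {K : Type*} (f : K → ℂ) (hf : Summable f) : Multipliable fun x => 1 - f x := by
  have := multipliable_one_add_of_summable (f := fun x => - f x) (by simpa using hf.norm)
  simpa [sub_eq_add_neg] using this

lemma aux_step {J : Type*} (g : J × ℕ → ℂ) (hg : Summable g) :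
    ∏' x : J × ℕ, (1 - g x) =
      (∏' j : J, (1 - g (j, 0))) * ∏' x : J × ℕ, (1 - g (x.1, x.2 + 1)) := by
  have i0 : Function.Injective (fun j : J => ((j, 0) : J × ℕ)) := by
    intro a b h; simpa using h
  have i1 : Function.Injective (fun x : J × ℕ => ((x.1, x.2 + 1) : J × ℕ)) := by
    rintro ⟨a, b⟩ ⟨c, d⟩ h; simpa using h
  have h0 : HasProd ((fun x => 1 - g x) ∘ (fun j : J => ((j, 0) : J × ℕ)))
      (∏' j : J, (1 - g (j, 0))) :=
    (aux_mult (fun j : J => g (j, 0)) (hg.comp_injective i0)).hasProd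
  have h1 : HasProd ((fun x => 1 - g x) ∘ (fun x : J × ℕ => ((x.1, x.2 + 1) : J × ℕ)))
      (∏' x : J × ℕ, (1 - g (x.1, x.2 + 1))) :=
    (aux_mult (fun x : J × ℕ => g (x.1, x.2 + 1)) (hg.comp_injective i1)).hasProd
  have h0' := (i0.hasProd_range_iff (f := fun x => 1 - g x)).2 h0
  have h1' := (i1.hasProd_range_iff (f := fun x => 1 - g x)).2 h1
  have hc : IsCompl (Set.range (fun j : J => ((j, 0) : J × ℕ)))
      (Set.range (fun x : J × ℕ => ((x.1, x.2 + 1) : J × ℕ))) := by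
    constructor
    · rw [Set.disjoint_left]
      rintro _ ⟨j, rfl⟩ ⟨x, hx⟩
      simp at hx
    · rw [codisjoint_iff_le_sup]
      rintro ⟨j, n⟩ -
      cases n with
      | zero => exact Or.inl ⟨j, rfl⟩
      | succ n => exact Or.inr ⟨(j, n), rfl⟩
  have h2 := HasProd.mul_isCompl (f := fun x : J × ℕ => 1 - g x) hc h0' h1'
  exact h2.tprod_eq

lemma aux_summable {I : Type*} (b : I → ℂ) (u v : I → ℂ) (r : ℝ) (hr : r < 1)
    (hu : ∀ i, ‖u i‖ ≤ r) (hv : ∀ i, ‖v i‖ ≤ r) (hb : Summable b) :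
    Summable fun x : I × ℕ × ℕ => b x.1 * u x.1 ^ x.2.1 * v x.1 ^ x.2.2 := by
  rcases isEmpty_or_nonempty I with h | ⟨⟨i0⟩⟩
  · exact (hasSum_empty).summable
  have hr0 : 0 ≤ r := (norm_nonneg _).trans (hu i0)
  have hgeo := summable_geometric_of_lt_one hr0 hr
  have h2 := hgeo.mul_of_nonneg hgeo (fun n => pow_nonneg hr0 n) (fun n => pow_nonneg hr0 n)
  have h3 := hb.norm.mul_of_nonneg h2 (fun n => norm_nonneg _)
    (fun n => mul_nonneg (pow_nonneg hr0 _) (pow_nonneg hr0 _))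
  refine Summable.of_norm_bounded h3 ?_
  rintro ⟨i, p, q⟩
  simp only [norm_mul, norm_pow, mul_assoc]
  gcongr
  · exact hu i
  · exact hv i

lemma aux_summable1 {I : Type*} (b : I → ℂ) (u : I → ℂ) (r : ℝ) (hr : r < 1)
    (hu : ∀ i, ‖u i‖ ≤ r) (hb : Summable b) :
    Summable fun x : I × ℕ => b x.1 * u x.1 ^ x.2 := by
  have := (aux_summable b u u r hr hu hu hb).comp_injective
    (i := fun x : I × ℕ => (x.1, x.2, 0)) (by rintro ⟨a, b⟩ ⟨c, d⟩ h; simpa using h)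
  simpa [Function.comp_def] using this

/-- peel off `q = 0`. -/
lemma aux_B {I : Type*} (b : I → ℂ) (u v : I → ℂ) (r : ℝ) (hr : r < 1)
    (hu : ∀ i, ‖u i‖ ≤ r) (hv : ∀ i, ‖v i‖ ≤ r) (hb : Summable b) :
    ∏' x : I × ℕ × ℕ, (1 - b x.1 * u x.1 ^ x.2.1 * v x.1 ^ x.2.2) =
      (∏' x : I × ℕ, (1 - b x.1 * u x.1 ^ x.2)) *
      ∏' x : I × ℕ × ℕ, (1 - (b x.1 * v x.1) * u x.1 ^ x.2.1 * v x.1 ^ x.2.2) := by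
  have h := aux_step (fun x : (I × ℕ) × ℕ => b x.1.1 * u x.1.1 ^ x.1.2 * v x.1.1 ^ x.2)
    ((Equiv.prodAssoc I ℕ ℕ).summable_iff.2 (aux_summable b u v r hr hu hv hb))
  rw [← (Equiv.prodAssoc I ℕ ℕ).tprod_eq, ← (Equiv.prodAssoc I ℕ ℕ).tprod_eq (fun x : I × ℕ × ℕ => (1 - (b x.1 * v x.1) * u x.1 ^ x.2.1 * v x.1 ^ x.2.2))]
  simp only [Equiv.prodAssoc_apply]
  rw [h]
  simp only [pow_zero, mul_one]
  congr 2
  ext x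
  ring

/-- peel off `p = 0, …, n - 1`. -/
lemma aux_C {I : Type*} (b : I → ℂ) (u : I → ℂ) (r : ℝ) (hr : r < 1)
    (hu : ∀ i, ‖u i‖ ≤ r) (hb : Summable b) (n : ℕ) :
    ∏' x : I × ℕ, (1 - b x.1 * u x.1 ^ x.2) =
      (∏ l ∈ Finset.range n, ∏' i : I, (1 - b i * u i ^ l)) *
      ∏' x : I × ℕ, (1 - (b x.1 * u x.1 ^ n) * u x.1 ^ x.2) := by
  induction n with
  | zero => simp
  | succ n ih =>
    have hs : Summable fun i => b i * u i ^ n :=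
      (aux_summable1 b u r hr hu hb).comp_injective (i := fun i : I => (i, n))
        (by intro a b h; simpa using h)
    rw [ih, aux_step _ (aux_summable1 _ u r hr hu hs), Finset.prod_range_succ, mul_assoc]
    simp only [pow_zero, mul_one]
    congr 3
    ext x
    ring

lemma aux_ne {K : Type*} (f : K → ℂ) (hf : Summable f) (h1 : ∀ x, ‖f x‖ < 1) :
    ∏' x, (1 - f x) ≠ 0 := by
  have := tprod_one_add_ne_zero_of_summable (f := fun x => - f x) ?_ (by simpa using hf.norm)
  · simpa [sub_eq_add_neg] using this
  · intro x h
    have : f x = 1 := by linear_combination -h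
    have h2 := h1 x
    rw [this] at h2
    simp at h2

lemma aux_lower {I : Type*} (ℓ : I → ℝ) (hℓ : ∀ i, 0 < ℓ i) (δ : ℝ) (hδ : δ < 2)
    (hsum : Summable fun i => Real.exp (-δ * ℓ i)) : ∃ c, 0 < c ∧ ∀ i, c ≤ ℓ i := by
  have h := hsum.tendsto_cofinite_zero.eventually (gt_mem_nhds (Real.exp_pos (-2)))
  rw [Filter.eventually_cofinite] at h
  have key : ∀ i, Real.exp (-δ * ℓ i) < Real.exp (-2) → 1 ≤ ℓ i := by
    intro i hi
    rw [Real.exp_lt_exp] at hi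
    by_contra! hl
    have := hℓ i
    nlinarith
  rcases Set.eq_empty_or_nonempty {i | ¬ Real.exp (-δ * ℓ i) < Real.exp (-2)} with he | hne
  · refine ⟨1, one_pos, fun i => key i ?_⟩
    by_contra hi
    have : i ∈ {i | ¬ Real.exp (-δ * ℓ i) < Real.exp (-2)} := hi
    rw [he] at this
    exact this
  · obtain ⟨j, -, hj⟩ := Set.exists_min_image _ ℓ h hne
    refine ⟨min 1 (ℓ j), lt_min one_pos (hℓ j), fun i => ?_⟩
    by_cases hi : Real.exp (-δ * ℓ i) < Real.exp (-2)
    · exact (min_le_left _ _).trans (key i hi)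
    · exact (min_le_right _ _).trans (hj i hi)

theorem statement5 {I : Type*} [Countable I] (ℓ θ : I → ℝ)
    (hℓ : ∀ i, 0 < ℓ i) (δ : ℝ) (hδ : δ < 2)
    (hsum : Summable fun i => Real.exp (-δ * ℓ i))
    (m : ℕ) (s : ℂ) (hs : 2 + (m : ℝ) / 2 < s.re) :
    Zs ℓ θ ((m : ℤ) + 2) (s - (m : ℂ) / 2 + 1) ≠ 0 ∧
    Zs ℓ θ (-((m : ℤ) + 2)) (s + (m : ℂ) / 2 + 1) ≠ 0 ∧
    (∏ l ∈ Finset.range (m + 1),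
        Rz ℓ θ ((m : ℤ) - 2 * (l : ℤ)) (s - (m : ℂ) / 2 + (l : ℂ))) =
      (Zs ℓ θ (m : ℤ) (s - (m : ℂ) / 2) * Zs ℓ θ (-(m : ℤ)) (s + (m : ℂ) / 2 + 2)) /
      (Zs ℓ θ ((m : ℤ) + 2) (s - (m : ℂ) / 2 + 1) *
        Zs ℓ θ (-((m : ℤ) + 2)) (s + (m : ℂ) / 2 + 1)) := by
  obtain ⟨c, hc, hcl⟩ := aux_lower ℓ hℓ δ hδ hsum
  obtain ⟨a, ha⟩ : ∃ a : I → ℂ, a = fun i => Complex.exp (Complex.I * ((m : ℂ) / 2) * (θ i : ℂ)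
    - (s - (m : ℂ) / 2) * (ℓ i : ℂ)) := ⟨_, rfl⟩
  obtain ⟨u, hu⟩ : ∃ u : I → ℂ, u = fun i => Complex.exp (-((ℓ i : ℂ) + Complex.I * (θ i : ℂ))) :=
    ⟨_, rfl⟩
  obtain ⟨v, hv⟩ : ∃ v : I → ℂ, v = fun i => Complex.exp (-((ℓ i : ℂ) - Complex.I * (θ i : ℂ))) :=
    ⟨_, rfl⟩
  have hr : Real.exp (-c) < 1 := by simpa using hc
  have hun : ∀ i, ‖u i‖ ≤ Real.exp (-c) := by
    intro i; simpa [hu, Complex.norm_exp] using hcl i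
  have hvn : ∀ i, ‖v i‖ ≤ Real.exp (-c) := by
    intro i; simpa [hv, Complex.norm_exp] using hcl i
  have han : ∀ i, ‖a i‖ = Real.exp (-(s.re - m / 2) * ℓ i) := by
    intro i
    rw [ha, Complex.norm_exp]
    congr 1
    simp
    ring
  have ha1 : ∀ i, ‖a i‖ < 1 := by
    intro i
    rw [han, Real.exp_lt_one_iff]
    have := hℓ i
    nlinarith
  have has : Summable a := by
    refine Summable.of_norm_bounded hsum fun i => ?_
    rw [han, Real.exp_le_exp]
    have := hℓ i
    nlinarith
  -- identification of the factors
  have hZ1 : Zs ℓ θ (m : ℤ) (s - (m : ℂ) / 2) =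
      ∏' x : I × ℕ × ℕ, (1 - a x.1 * u x.1 ^ x.2.1 * v x.1 ^ x.2.2) := by
    unfold Zs
    refine tprod_congr fun x => ?_
    simp only [ha, hu, hv, ← Complex.exp_nat_mul, ← Complex.exp_add]
    congr 2; push_cast; ring
  have hZ2 : Zs ℓ θ ((m : ℤ) + 2) (s - (m : ℂ) / 2 + 1) =
      ∏' x : I × ℕ × ℕ, (1 - (a x.1 * v x.1) * u x.1 ^ x.2.1 * v x.1 ^ x.2.2) := by
    unfold Zs
    refine tprod_congr fun x => ?_
    simp only [ha, hu, hv, ← Complex.exp_nat_mul, ← Complex.exp_add]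
    congr 2; push_cast; ring
  have hZ3 : Zs ℓ θ (-((m : ℤ) + 2)) (s + (m : ℂ) / 2 + 1) =
      ∏' x : I × ℕ × ℕ, (1 - (a x.1 * u x.1 ^ (m + 1)) * u x.1 ^ x.2.1 * v x.1 ^ x.2.2) := by
    unfold Zs
    refine tprod_congr fun x => ?_
    simp only [ha, hu, hv, ← Complex.exp_nat_mul, ← Complex.exp_add]
    congr 2; push_cast; ring
  have hZ4 : Zs ℓ θ (-(m : ℤ)) (s + (m : ℂ) / 2 + 2) =
      ∏' x : I × ℕ × ℕ,
        (1 - (a x.1 * u x.1 ^ (m + 1) * v x.1) * u x.1 ^ x.2.1 * v x.1 ^ x.2.2) := by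
    unfold Zs
    refine tprod_congr fun x => ?_
    simp only [ha, hu, hv, ← Complex.exp_nat_mul, ← Complex.exp_add]
    congr 2; push_cast; ring
  have hR : ∀ l : ℕ, Rz ℓ θ ((m : ℤ) - 2 * (l : ℤ)) (s - (m : ℂ) / 2 + (l : ℂ)) =
      ∏' i : I, (1 - a i * u i ^ l) := by
    intro l
    unfold Rz
    refine tprod_congr fun x => ?_
    simp only [ha, hu, ← Complex.exp_nat_mul, ← Complex.exp_add]
    congr 2; push_cast; ring
  have hS := aux_summable a u v _ hr hun hvn has
  have hav : Summable fun i => a i * v i := by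
    have := hS.comp_injective (i := fun i : I => (i, 0, 1)) (by intro a b h; simpa using h)
    simpa [Function.comp_def] using this
  have hau : Summable fun i => a i * u i ^ (m + 1) := by
    have := hS.comp_injective (i := fun i : I => (i, m + 1, 0)) (by intro a b h; simpa using h)
    simpa [Function.comp_def] using this
  have hlt : ∀ i (p q : ℕ), ‖a i * u i ^ p * v i ^ q‖ < 1 := by
    intro i p q
    rw [norm_mul, norm_mul, norm_pow, norm_pow]
    have h1 : ‖u i‖ ^ p ≤ 1 := pow_le_one₀ (norm_nonneg _) ((hun i).trans hr.le)
    have h2 : ‖v i‖ ^ q ≤ 1 := pow_le_one₀ (norm_nonneg _) ((hvn i).trans hr.le)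
    calc ‖a i‖ * ‖u i‖ ^ p * ‖v i‖ ^ q ≤ ‖a i‖ * 1 * 1 := by gcongr
      _ < 1 := by simpa using ha1 i
  have hn2 : Zs ℓ θ ((m : ℤ) + 2) (s - (m : ℂ) / 2 + 1) ≠ 0 := by
    rw [hZ2]
    have hS' := aux_summable (fun i => a i * v i) u v _ hr hun hvn hav
    refine aux_ne _ hS' fun x => ?_
    convert hlt x.1 x.2.1 (x.2.2 + 1) using 2
    ring
  have hn3 : Zs ℓ θ (-((m : ℤ) + 2)) (s + (m : ℂ) / 2 + 1) ≠ 0 := by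
    rw [hZ3]
    have hS' := aux_summable (fun i => a i * u i ^ (m + 1)) u v _ hr hun hvn hau
    refine aux_ne _ hS' fun x => ?_
    convert hlt x.1 (m + 1 + x.2.1) x.2.2 using 2
    ring
  refine ⟨hn2, hn3, ?_⟩
  rw [eq_div_iff (mul_ne_zero hn2 hn3), hZ1, hZ2, hZ3, hZ4, aux_B a u v _ hr hun hvn has,
    aux_B _ u v _ hr hun hvn hau, aux_C a u _ hr hun has (m + 1)]
  simp only [hR]
  ring
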